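/- For all n ≥ 1: if n is even, then the polynomial Y_n − (−1)^{n/2}·2·x^{3n/2} has total degree at most (3n−2)/2; if n is odd, then the polynomial Y_n − (−1)^{(n−1)/2}·n·x^{(3n−3)/2}·y has total degree at most (3n−3)/2. -/

import Mathlib

open MvPolynomial

set_option maxHeartbeats 1000000

/-- The first coordinates `X_n ∈ ℤ[x,y]` of the folding maps `G_n = 𝖥_n[𝒢₂]`
(with `X 0 = x`, `X 1 = y`), given by the initial values `X_0,…,X_5` and the recursion
`X_{n+6} = x(X_{n+5}+X_{n+1}) − (x+y+3)(X_{n+4}+X_{n+2}) + (x²−2y−4)X_{n+3} − X_n`. -/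
noncomputable def XG : ℕ → MvPolynomial (Fin 2) ℤ
  | 0 => 6
  | 1 => X 0
  | 2 => X 0 ^ 2 - 2 * X 0 - 2 * X 1 - 6
  | 3 => X 0 ^ 3 - 3 * X 0 * X 1 - 9 * X 0 - 6 * X 1 - 12
  | 4 => X 0 ^ 4 - 4 * X 0 ^ 2 * X 1 - 10 * X 0 ^ 2 - 4 * X 0 * X 1 + 2 * X 1 ^ 2
      - 8 * X 0 + 8 * X 1 + 6
  | 5 => X 0 ^ 5 - 5 * X 0 ^ 3 * X 1 - 15 * X 0 ^ 3 - 5 * X 0 ^ 2 * X 1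
      + 5 * X 0 * X 1 ^ 2 - 10 * X 0 ^ 2 + 35 * X 0 * X 1 + 10 * X 1 ^ 2
      + 55 * X 0 + 50 * X 1 + 60
  | n + 6 => X 0 * (XG (n + 5) + XG (n + 1)) - (X 0 + X 1 + 3) * (XG (n + 4) + XG (n + 2))
      + (X 0 ^ 2 - 2 * X 1 - 4) * XG (n + 3) - XG n

/-- The second coordinates `Y_n ∈ ℤ[x,y]` of the folding maps `G_n = 𝖥_n[𝒢₂]`
(with `X 0 = x`, `X 1 = y`), given by the initial values `Y_0,…,Y_5` and the recursion
`Y_{n+6} = y(Y_{n+5}+Y_{n+1}) − (x³−3xy−9x−5y−9)(Y_{n+4}+Y_{n+2})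
+ (y²−2x³+6xy+18x+12y+8)Y_{n+3} − Y_n`. -/
noncomputable def YG : ℕ → MvPolynomial (Fin 2) ℤ
  | 0 => 6
  | 1 => X 1
  | 2 => -2 * X 0 ^ 3 + 6 * X 0 * X 1 + X 1 ^ 2 + 18 * X 0 + 10 * X 1 + 18
  | 3 => -3 * X 0 ^ 3 * X 1 - 6 * X 0 ^ 3 + 9 * X 0 * X 1 ^ 2 + X 1 ^ 3
      + 45 * X 0 * X 1 + 18 * X 1 ^ 2 + 54 * X 0 + 63 * X 1 + 60
  | 4 => 2 * X 0 ^ 6 - 12 * X 0 ^ 4 * X 1 - 4 * X 0 ^ 3 * X 1 ^ 2 - 36 * X 0 ^ 4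
      - 28 * X 0 ^ 3 * X 1 + 18 * X 0 ^ 2 * X 1 ^ 2 + 12 * X 0 * X 1 ^ 3 + X 1 ^ 4
      - 40 * X 0 ^ 3 + 108 * X 0 ^ 2 * X 1 + 120 * X 0 * X 1 ^ 2 + 24 * X 1 ^ 3
      + 162 * X 0 ^ 2 + 372 * X 0 * X 1 + 134 * X 1 ^ 2 + 360 * X 0 + 280 * X 1 + 198
  | 5 => 5 * X 0 ^ 6 * X 1 + 10 * X 0 ^ 6 - 30 * X 0 ^ 4 * X 1 ^ 2 - 5 * X 0 ^ 3 * X 1 ^ 3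
      - 150 * X 0 ^ 4 * X 1 - 65 * X 0 ^ 3 * X 1 ^ 2 + 45 * X 0 ^ 2 * X 1 ^ 3
      + 15 * X 0 * X 1 ^ 4 + X 1 ^ 5 - 180 * X 0 ^ 4 - 205 * X 0 ^ 3 * X 1
      + 360 * X 0 ^ 2 * X 1 ^ 2 + 240 * X 0 * X 1 ^ 3 + 30 * X 1 ^ 4 - 190 * X 0 ^ 3
      + 945 * X 0 ^ 2 * X 1 + 1200 * X 0 * X 1 ^ 2 + 255 * X 1 ^ 3 + 810 * X 0 ^ 2
      + 2415 * X 0 * X 1 + 920 * X 1 ^ 2 + 1710 * X 0 + 1495 * X 1 + 900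
  | n + 6 => X 1 * (YG (n + 5) + YG (n + 1))
      - (X 0 ^ 3 - 3 * X 0 * X 1 - 9 * X 0 - 5 * X 1 - 9) * (YG (n + 4) + YG (n + 2))
      + (X 1 ^ 2 - 2 * X 0 ^ 3 + 6 * X 0 * X 1 + 18 * X 0 + 12 * X 1 + 8) * YG (n + 3)
      - YG n

namespace MvPolynomial

section TotalDegreeBounds

variable {σ R : Type*} [CommRing R] {p q : MvPolynomial σ R} {a b d : ℕ}

theorem totalDegree_add_le_max (hp : p.totalDegree ≤ a) (hq : q.totalDegree ≤ b) :
    (p + q).totalDegree ≤ max a b :=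
  (totalDegree_add p q).trans (max_le_max hp hq)

theorem totalDegree_sub_le_max (hp : p.totalDegree ≤ a) (hq : q.totalDegree ≤ b) :
    (p - q).totalDegree ≤ max a b :=
  (totalDegree_sub p q).trans (max_le_max hp hq)

theorem totalDegree_add_le_of_le (hp : p.totalDegree ≤ d) (hq : q.totalDegree ≤ d) :
    (p + q).totalDegree ≤ d :=
  (totalDegree_add p q).trans (max_le hp hq)

theorem totalDegree_sub_le_of_le (hp : p.totalDegree ≤ d) (hq : q.totalDegree ≤ d) :
    (p - q).totalDegree ≤ d :=
  (totalDegree_sub p q).trans (max_le hp hq)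

theorem totalDegree_mul_le_add (hp : p.totalDegree ≤ a) (hq : q.totalDegree ≤ b) :
    (p * q).totalDegree ≤ a + b :=
  (totalDegree_mul p q).trans (add_le_add hp hq)

theorem totalDegree_mul_le_of_le (hp : p.totalDegree ≤ a) (hq : q.totalDegree ≤ b)
    (h : a + b ≤ d) : (p * q).totalDegree ≤ d :=
  (totalDegree_mul_le_add hp hq).trans h

theorem totalDegree_neg_le (hp : p.totalDegree ≤ a) : (-p).totalDegree ≤ a :=
  (totalDegree_neg p).trans_le hp

theorem totalDegree_X_pow_le (i : σ) (k : ℕ) :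
    (X i ^ k : MvPolynomial σ R).totalDegree ≤ k := by
  cases subsingleton_or_nontrivial R
  · simp [Subsingleton.elim (X i ^ k : MvPolynomial σ R) 0]
  · exact (totalDegree_X_pow i k).le

theorem totalDegree_X_le (i : σ) : (X i : MvPolynomial σ R).totalDegree ≤ 1 := by
  simpa using totalDegree_X_pow_le (R := R) i 1

theorem totalDegree_ofNat_le (k : ℕ) [k.AtLeastTwo] :
    (OfNat.ofNat k : MvPolynomial σ R).totalDegree ≤ 0 :=
  (totalDegree_C (OfNat.ofNat k : R)).le

end TotalDegreeBounds

end MvPolynomial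

/-- The leading term of `YG (2 * k)`. -/
noncomputable def evenLead (k : ℕ) : MvPolynomial (Fin 2) ℤ :=
  C ((-1 : ℤ) ^ k * 2) * X 0 ^ (3 * k)

/-- The leading term of `YG (2 * k + 1)`. -/
noncomputable def oddLead (k : ℕ) : MvPolynomial (Fin 2) ℤ :=
  C ((-1 : ℤ) ^ k * (2 * k + 1)) * X 0 ^ (3 * k) * X 1

theorem totalDegree_evenLead_le (k : ℕ) : (evenLead k).totalDegree ≤ 3 * k :=
  totalDegree_mul_le_of_le (totalDegree_C _).le (totalDegree_X_pow_le _ _) (by omega)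

theorem totalDegree_oddLead_le (k : ℕ) : (oddLead k).totalDegree ≤ 3 * k + 1 :=
  totalDegree_mul_le_add
    (totalDegree_mul_le_of_le (totalDegree_C _).le (totalDegree_X_pow_le _ _) (zero_add _).le)
    (totalDegree_X_le _)

theorem evenLead_succ (k : ℕ) : evenLead (k + 1) = -(X 0 ^ 3 * evenLead k) := by
  simp only [evenLead, map_mul, map_pow, map_neg, map_one]
  ring

theorem oddLead_succ (k : ℕ) :
    oddLead (k + 1) = X 1 * evenLead (k + 1) - X 0 ^ 3 * oddLead k := by
  simp only [oddLead, evenLead, map_mul, map_pow, map_neg, map_one, map_add, Nat.cast_add,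
    Nat.cast_one, map_natCast, map_ofNat]
  ring

/-- `YG (2 * k)` and `YG (2 * k + 1)` agree with their leading terms up to lower total degree. -/
def YGLeading (k : ℕ) : Prop :=
  (YG (2 * k) - evenLead k).totalDegree ≤ 3 * k - 1 ∧
    (YG (2 * k + 1) - oddLead k).totalDegree ≤ 3 * k

theorem YGLeading.totalDegree_even_le {k : ℕ} (h : YGLeading k) :
    (YG (2 * k)).totalDegree ≤ 3 * k := by
  rw [← sub_add_cancel (YG (2 * k)) (evenLead k)]
  exact totalDegree_add_le_of_le (h.1.trans (Nat.sub_le _ _)) (totalDegree_evenLead_le k)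

theorem YGLeading.totalDegree_odd_le {k : ℕ} (h : YGLeading k) :
    (YG (2 * k + 1)).totalDegree ≤ 3 * k + 1 := by
  rw [← sub_add_cancel (YG (2 * k + 1)) (oddLead k)]
  exact totalDegree_add_le_of_le (h.2.trans (Nat.le_succ _)) (totalDegree_oddLead_le k)

theorem YGLeading_zero : YGLeading 0 := by
  constructor
  · have e : YG (2 * 0) - evenLead 0 = 4 := by
      simp only [evenLead, YG, mul_zero, pow_zero, one_mul, mul_one, map_ofNat]
      norm_num
    rw [e]
    exact totalDegree_ofNat_le 4
  · simp [oddLead, YG]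

theorem YGLeading_one : YGLeading 1 := by
  constructor
  · have e : YG (2 * 1) - evenLead 1 =
        6 * X 0 * X 1 + X 1 ^ 2 + 18 * X 0 + 10 * X 1 + 18 := by
      simp only [evenLead, YG, map_mul, map_pow, map_neg, map_one, map_ofNat]
      ring
    rw [e]
    apply le_trans
    · repeat' with_reducible first
        | apply totalDegree_add_le_max
        | apply totalDegree_sub_le_max
        | apply totalDegree_mul_le_add
        | apply totalDegree_neg_le
        | apply totalDegree_X_pow_le
        | apply totalDegree_X_le
        | apply totalDegree_ofNat_le
    · decide
  · have e : YG (2 * 1 + 1) - oddLead 1 =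
        -6 * X 0 ^ 3 + 9 * X 0 * X 1 ^ 2 + X 1 ^ 3
          + 45 * X 0 * X 1 + 18 * X 1 ^ 2 + 54 * X 0 + 63 * X 1 + 60 := by
      simp only [oddLead, YG, map_mul, map_pow, map_neg, map_one, map_ofNat, map_add, Nat.cast_one]
      ring
    rw [e]
    apply le_trans
    · repeat' with_reducible first
        | apply totalDegree_add_le_max
        | apply totalDegree_sub_le_max
        | apply totalDegree_mul_le_add
        | apply totalDegree_neg_le
        | apply totalDegree_X_pow_le
        | apply totalDegree_X_le
        | apply totalDegree_ofNat_le
    · decide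

theorem YGLeading_two : YGLeading 2 := by
  constructor
  · have e : YG (2 * 2) - evenLead 2 =
        -12 * X 0 ^ 4 * X 1 - 4 * X 0 ^ 3 * X 1 ^ 2 - 36 * X 0 ^ 4
          - 28 * X 0 ^ 3 * X 1 + 18 * X 0 ^ 2 * X 1 ^ 2 + 12 * X 0 * X 1 ^ 3 + X 1 ^ 4
          - 40 * X 0 ^ 3 + 108 * X 0 ^ 2 * X 1 + 120 * X 0 * X 1 ^ 2 + 24 * X 1 ^ 3
          + 162 * X 0 ^ 2 + 372 * X 0 * X 1 + 134 * X 1 ^ 2 + 360 * X 0 + 280 * X 1 + 198 := by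
      simp only [evenLead, YG, map_mul, map_pow, map_neg, map_one, map_ofNat]
      ring
    rw [e]
    apply le_trans
    · repeat' with_reducible first
        | apply totalDegree_add_le_max
        | apply totalDegree_sub_le_max
        | apply totalDegree_mul_le_add
        | apply totalDegree_neg_le
        | apply totalDegree_X_pow_le
        | apply totalDegree_X_le
        | apply totalDegree_ofNat_le
    · decide
  · have e : YG (2 * 2 + 1) - oddLead 2 =
        10 * X 0 ^ 6 - 30 * X 0 ^ 4 * X 1 ^ 2 - 5 * X 0 ^ 3 * X 1 ^ 3
          - 150 * X 0 ^ 4 * X 1 - 65 * X 0 ^ 3 * X 1 ^ 2 + 45 * X 0 ^ 2 * X 1 ^ 3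
          + 15 * X 0 * X 1 ^ 4 + X 1 ^ 5 - 180 * X 0 ^ 4 - 205 * X 0 ^ 3 * X 1
          + 360 * X 0 ^ 2 * X 1 ^ 2 + 240 * X 0 * X 1 ^ 3 + 30 * X 1 ^ 4 - 190 * X 0 ^ 3
          + 945 * X 0 ^ 2 * X 1 + 1200 * X 0 * X 1 ^ 2 + 255 * X 1 ^ 3 + 810 * X 0 ^ 2
          + 2415 * X 0 * X 1 + 920 * X 1 ^ 2 + 1710 * X 0 + 1495 * X 1 + 900 := by
      simp only [oddLead, YG, map_mul, map_pow, map_neg, map_one, map_ofNat, map_add,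
        Nat.cast_ofNat]
      ring
    rw [e]
    apply le_trans
    · repeat' with_reducible first
        | apply totalDegree_add_le_max
        | apply totalDegree_sub_le_max
        | apply totalDegree_mul_le_add
        | apply totalDegree_neg_le
        | apply totalDegree_X_pow_le
        | apply totalDegree_X_le
        | apply totalDegree_ofNat_le
    · decide

/-- The lower order part of the coefficient of `YG (n + 4) + YG (n + 2)` in the recursion. -/
theorem totalDegree_coeff_four_lower_le :
    (3 * X 0 * X 1 + 9 * X 0 + 5 * X 1 + 9 : MvPolynomial (Fin 2) ℤ).totalDegree ≤ 2 := by
  apply le_trans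
  · repeat' with_reducible first
      | apply totalDegree_add_le_max
      | apply totalDegree_sub_le_max
      | apply totalDegree_mul_le_add
      | apply totalDegree_neg_le
      | apply totalDegree_X_pow_le
      | apply totalDegree_X_le
      | apply totalDegree_ofNat_le
  · decide

theorem totalDegree_coeff_four_le :
    (X 0 ^ 3 - 3 * X 0 * X 1 - 9 * X 0 - 5 * X 1 - 9 :
      MvPolynomial (Fin 2) ℤ).totalDegree ≤ 3 := by
  apply le_trans
  · repeat' with_reducible first
      | apply totalDegree_add_le_max
      | apply totalDegree_sub_le_max
      | apply totalDegree_mul_le_add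
      | apply totalDegree_neg_le
      | apply totalDegree_X_pow_le
      | apply totalDegree_X_le
      | apply totalDegree_ofNat_le
  · decide

theorem totalDegree_coeff_three_le :
    (X 1 ^ 2 - 2 * X 0 ^ 3 + 6 * X 0 * X 1 + 18 * X 0 + 12 * X 1 + 8 :
      MvPolynomial (Fin 2) ℤ).totalDegree ≤ 3 := by
  apply le_trans
  · repeat' with_reducible first
      | apply totalDegree_add_le_max
      | apply totalDegree_sub_le_max
      | apply totalDegree_mul_le_add
      | apply totalDegree_neg_le
      | apply totalDegree_X_pow_le
      | apply totalDegree_X_le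
      | apply totalDegree_ofNat_le
  · decide

theorem totalDegree_YG_even_sub_evenLead_le {k : ℕ} (h₀ : YGLeading k)
    (h₁ : YGLeading (k + 1)) (h₂ : YGLeading (k + 2)) :
    (YG (2 * (k + 3)) - evenLead (k + 3)).totalDegree ≤ 3 * (k + 3) - 1 := by
  have e : YG (2 * (k + 3)) - evenLead (k + 3) =
      X 1 * (YG (2 * (k + 2) + 1) + YG (2 * k + 1))
        - X 0 ^ 3 * (YG (2 * (k + 2)) - evenLead (k + 2))
        + (3 * X 0 * X 1 + 9 * X 0 + 5 * X 1 + 9) * YG (2 * (k + 2))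
        - (X 0 ^ 3 - 3 * X 0 * X 1 - 9 * X 0 - 5 * X 1 - 9) * YG (2 * (k + 1))
        + (X 1 ^ 2 - 2 * X 0 ^ 3 + 6 * X 0 * X 1 + 18 * X 0 + 12 * X 1 + 8)
          * YG (2 * (k + 1) + 1)
        - YG (2 * k) := by
    rw [evenLead_succ (k + 2), show 2 * (k + 3) = 2 * k + 6 by ring, YG]
    ring_nf
  rw [e]
  refine totalDegree_sub_le_of_le (totalDegree_add_le_of_le (totalDegree_sub_le_of_le
    (totalDegree_add_le_of_le (totalDegree_sub_le_of_le ?_ ?_) ?_) ?_) ?_) ?_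
  · exact totalDegree_mul_le_of_le (totalDegree_X_le _)
      (totalDegree_add_le_max h₂.totalDegree_odd_le h₀.totalDegree_odd_le) (by omega)
  · exact totalDegree_mul_le_of_le (totalDegree_X_pow_le _ _) h₂.1 (by omega)
  · exact totalDegree_mul_le_of_le totalDegree_coeff_four_lower_le h₂.totalDegree_even_le
      (by omega)
  · exact totalDegree_mul_le_of_le totalDegree_coeff_four_le h₁.totalDegree_even_le (by omega)
  · exact totalDegree_mul_le_of_le totalDegree_coeff_three_le h₁.totalDegree_odd_le (by omega)
  · exact h₀.totalDegree_even_le.trans (by omega)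

theorem totalDegree_YG_odd_sub_oddLead_le {k : ℕ} (h₀ : YGLeading k)
    (h₁ : YGLeading (k + 1)) (h₂ : YGLeading (k + 2))
    (h₃ : (YG (2 * (k + 3)) - evenLead (k + 3)).totalDegree ≤ 3 * (k + 3) - 1) :
    (YG (2 * (k + 3) + 1) - oddLead (k + 3)).totalDegree ≤ 3 * (k + 3) := by
  have e : YG (2 * (k + 3) + 1) - oddLead (k + 3) =
      X 1 * (YG (2 * (k + 3)) - evenLead (k + 3)) + X 1 * YG (2 * (k + 1))
        - X 0 ^ 3 * (YG (2 * (k + 2) + 1) - oddLead (k + 2))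
        + (3 * X 0 * X 1 + 9 * X 0 + 5 * X 1 + 9) * YG (2 * (k + 2) + 1)
        - (X 0 ^ 3 - 3 * X 0 * X 1 - 9 * X 0 - 5 * X 1 - 9) * YG (2 * (k + 1) + 1)
        + (X 1 ^ 2 - 2 * X 0 ^ 3 + 6 * X 0 * X 1 + 18 * X 0 + 12 * X 1 + 8)
          * YG (2 * (k + 2))
        - YG (2 * k + 1) := by
    rw [oddLead_succ (k + 2), show 2 * (k + 3) + 1 = (2 * k + 1) + 6 by ring, YG]
    ring_nf
  rw [e]
  refine totalDegree_sub_le_of_le (totalDegree_add_le_of_le (totalDegree_sub_le_of_le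
    (totalDegree_add_le_of_le (totalDegree_sub_le_of_le (totalDegree_add_le_of_le ?_ ?_) ?_)
      ?_) ?_) ?_) ?_
  · exact totalDegree_mul_le_of_le (totalDegree_X_le _) h₃ (by omega)
  · exact totalDegree_mul_le_of_le (totalDegree_X_le _) h₁.totalDegree_even_le (by omega)
  · exact totalDegree_mul_le_of_le (totalDegree_X_pow_le _ _) h₂.2 (by omega)
  · exact totalDegree_mul_le_of_le totalDegree_coeff_four_lower_le h₂.totalDegree_odd_le
      (by omega)
  · exact totalDegree_mul_le_of_le totalDegree_coeff_four_le h₁.totalDegree_odd_le (by omega)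
  · exact totalDegree_mul_le_of_le totalDegree_coeff_three_le h₂.totalDegree_even_le (by omega)
  · exact h₀.totalDegree_odd_le.trans (by omega)

theorem yGLeading (k : ℕ) : YGLeading k := by
  induction k using Nat.strong_induction_on with
  | _ k ih =>
    match k with
    | 0 => exact YGLeading_zero
    | 1 => exact YGLeading_one
    | 2 => exact YGLeading_two
    | k + 3 =>
      have h₀ := ih k (by omega)
      have h₁ := ih (k + 1) (by omega)
      have h₂ := ih (k + 2) (by omega)
      have h₃ := totalDegree_YG_even_sub_evenLead_le h₀ h₁ h₂
      exact ⟨h₃, totalDegree_YG_odd_sub_oddLead_le h₀ h₁ h₂ h₃⟩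

/-- For `n ≥ 1`: if `n` is even then `Y_n − (−1)^{n/2}·2·x^{3n/2}` has total degree
at most `(3n−2)/2`, and if `n` is odd then `Y_n − (−1)^{(n−1)/2}·n·x^{(3n−3)/2}·y`
has total degree at most `(3n−3)/2`. -/
theorem YG_leading_terms (n : ℕ) (hn : 1 ≤ n) :
    (Even n →
      (YG n - C ((-1 : ℤ) ^ (n / 2) * 2) * X 0 ^ (3 * n / 2)).totalDegree
        ≤ (3 * n - 2) / 2) ∧
    (Odd n →
      (YG n - C ((-1 : ℤ) ^ ((n - 1) / 2) * (n : ℤ)) * X 0 ^ ((3 * n - 3) / 2)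
          * X 1).totalDegree
        ≤ (3 * n - 3) / 2) := by
  constructor
  · rintro ⟨k, rfl⟩
    have h := (yGLeading k).1
    rw [evenLead] at h
    rw [show k + k = 2 * k by ring, show 2 * k / 2 = k by omega,
      show 3 * (2 * k) / 2 = 3 * k by omega]
    exact h.trans (by omega)
  · rintro ⟨k, rfl⟩
    have h := (yGLeading k).2
    rw [oddLead] at h
    rw [show (2 * k + 1 - 1) / 2 = k by omega, show (3 * (2 * k + 1) - 3) / 2 = 3 * k by omega]
    push_cast
    exact h
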